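/- arXiv:2209.12524 — 5 statements merged into one kernel-verified Lean document; each statement's English description precedes it below -/
import Mathlib

section
/- For every z in Ω = ℂ ∖ ((−∞,0] ∪ [1,∞)), the quadratic equation X² + 4z·X − 2X + 1 = 0 has exactly one solution X ∈ ℂ with Im X > 0 (equivalently: it has exactly one root whose argument lies in (0,π)). -/
open Complex Set

/-- `Ω = ℂ \ ((-∞,0] ∪ [1,∞))`, the complex plane with the two real slits removed. -/
def Ω : Set ℂ := {z : ℂ | z ∉ (fun x : ℝ => (x : ℂ)) '' (Set.Iic 0 ∪ Set.Ici 1)}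

/-- For `z ∈ Ω`, the quadratic `X² + 4z·X − 2X + 1` has no real root. -/
lemma quadratic_root_im_ne_zero {z X : ℂ} (hz : z ∈ Ω)
    (hX : X ^ 2 + 4 * z * X - 2 * X + 1 = 0) : X.im ≠ 0 := by
  intro him
  obtain ⟨r, rfl⟩ : ∃ r : ℝ, (r : ℂ) = X := ⟨X.re, Complex.ext rfl him.symm⟩
  have hr : r ≠ 0 := by
    rintro rfl
    simp at hX
  have hr' : (r : ℂ) ≠ 0 := Complex.ofReal_ne_zero.2 hr
  refine hz ⟨-(r - 1) ^ 2 / (4 * r), ?_, ?_⟩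
  · rcases hr.lt_or_gt with h | h
    · right
      rw [Set.mem_Ici, le_div_iff_of_neg (by linarith)]
      nlinarith [sq_nonneg (r + 1)]
    · left
      rw [Set.mem_Iic, div_le_iff₀ (by linarith)]
      nlinarith [sq_nonneg (r - 1)]
  · push_cast
    rw [div_eq_iff (by simpa using hr)]
    linear_combination -hX

/-- If `X * Y = 1` and `X` lies in the upper half plane, then `Y` does not. -/
lemma im_neg_of_mul_eq_one {X Y : ℂ} (h : X * Y = 1) (hX : 0 < X.im) : Y.im < 0 := by
  have hX0 : X ≠ 0 := by
    rintro rfl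
    simp at hX
  rw [eq_inv_of_mul_eq_one_right h, Complex.inv_im]
  exact div_neg_of_neg_of_pos (neg_neg_of_pos hX) (Complex.normSq_pos.2 hX0)

/-- For every `z ∈ Ω`, the quadratic `X² + 4z·X − 2X + 1 = 0` has exactly one solution
with positive imaginary part. -/
theorem quadratic_unique_root_upper (z : ℂ) (hz : z ∈ Ω) :
    ∃! X : ℂ, 0 < X.im ∧ X ^ 2 + 4 * z * X - 2 * X + 1 = 0 := by
  have hex : ∃ X : ℂ, X ^ 2 + 4 * z * X - 2 * X + 1 = 0 := by
    obtain ⟨s, hs⟩ := IsAlgClosed.exists_pow_nat_eq ((2 * z - 1) ^ 2 - 1) (n := 2) two_pos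
    exact ⟨1 - 2 * z + s, by linear_combination hs⟩
  obtain ⟨X, hX⟩ := hex
  have hupper : ∃ X : ℂ, 0 < X.im ∧ X ^ 2 + 4 * z * X - 2 * X + 1 = 0 := by
    rcases (quadratic_root_im_ne_zero hz hX).lt_or_gt with h | h
    · refine ⟨2 - 4 * z - X, ?_, by linear_combination hX⟩
      have hmul : -X * -(2 - 4 * z - X) = 1 := by linear_combination -hX
      have := im_neg_of_mul_eq_one hmul (by simpa using h)
      rw [Complex.neg_im] at this
      linarith
    · exact ⟨X, h, hX⟩
  obtain ⟨X, hpos, hX⟩ := hupper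
  refine ⟨X, ⟨hpos, hX⟩, ?_⟩
  rintro Y ⟨hYpos, hY⟩
  by_contra hne
  have hsum : X + Y + 4 * z - 2 = 0 :=
    mul_left_cancel₀ (sub_ne_zero.2 hne) (by linear_combination hY - hX)
  have hmul : X * Y = 1 := by linear_combination X * hsum - hX
  exact (im_neg_of_mul_eq_one hmul hpos).not_gt hYpos
end

section
/- For every z ∈ Ω, each of the three numbers w₁(z), w₂(z), w₃(z) satisfies the cubic equation w³ − (3/2)·w² + z/2 = 0, and w₁(z), w₂(z), w₃(z) are pairwise distinct; that is, they are the three roots of this cubic. -/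
open Complex Filter Asymptotics Set

/-- `ω = e^{2πi/3}`. -/
noncomputable def ω : ℂ := Complex.exp (2 * Real.pi * Complex.I / 3)

theorem ω_sq_add_ω_add_one : ω ^ 2 + ω + 1 = 0 := by
  have h : IsPrimitiveRoot ω 3 := by
    simpa [ω] using Complex.isPrimitiveRoot_exp 3 (by norm_num)
  have hs := h.geom_sum_eq_zero (by norm_num)
  simp only [Finset.sum_range_succ, Finset.sum_range_zero, pow_zero, pow_one] at hs
  linear_combination hs

/-- Cardano's formula for `w³ − (3/2)w² + z/2 = 0`. -/
theorem cubic_eq_zero_of_mul_eq_one {s t z : ℂ} (hst : s * t = 1)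
    (hsum : s ^ 3 + t ^ 3 = 2 - 4 * z) :
    ((1 / 2) * (s + t + 1)) ^ 3 - (3 / 2) * ((1 / 2) * (s + t + 1)) ^ 2 + z / 2 = 0 := by
  linear_combination (1 / 8) * hsum + (3 / 8) * (s + t) * hst

/-- For `z ∈ Ω` the three `w`-functions are the three (pairwise distinct) roots of the
cubic `w³ − (3/2)w² + z/2 = 0`. -/
theorem w_functions_roots_of_cubic
    (η : ℂ → ℂ)
    (hη : ∀ z ∈ Ω, 0 < (η z).im ∧ (η z) ^ 2 + 4 * z * (η z) - 2 * (η z) + 1 = 0)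
    (w₁ w₂ w₃ : ℂ → ℂ)
    (hw₁ : ∀ z, w₁ z = (1 / 2) * ((η z) ^ ((1 : ℂ) / 3) + (η z) ^ (-(1 : ℂ) / 3) + 1))
    (hw₂ : ∀ z, w₂ z = (1 / 2) * (ω⁻¹ * (η z) ^ ((1 : ℂ) / 3) + ω * (η z) ^ (-(1 : ℂ) / 3) + 1))
    (hw₃ : ∀ z, w₃ z = (1 / 2) * (ω * (η z) ^ ((1 : ℂ) / 3) + ω⁻¹ * (η z) ^ (-(1 : ℂ) / 3) + 1))
    (z : ℂ) (hz : z ∈ Ω) :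
    w₁ z ^ 3 - (3 / 2) * w₁ z ^ 2 + z / 2 = 0 ∧
    w₂ z ^ 3 - (3 / 2) * w₂ z ^ 2 + z / 2 = 0 ∧
    w₃ z ^ 3 - (3 / 2) * w₃ z ^ 2 + z / 2 = 0 ∧
    w₁ z ≠ w₂ z ∧ w₁ z ≠ w₃ z ∧ w₂ z ≠ w₃ z := by
  obtain ⟨him, hquad⟩ := hη z hz
  have hη0 : η z ≠ 0 := fun h => by simp [h] at him
  have hω := ω_sq_add_ω_add_one
  have hω3 : ω ^ 3 = 1 := by linear_combination (ω - 1) * hω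
  have hω0 : ω ≠ 0 := fun h => by simp [h] at hω
  have hω1 : ω - 1 ≠ 0 := fun h => by
    have h1 : ω = 1 := sub_eq_zero.mp h
    norm_num [h1] at hω
  have hωinv : ω⁻¹ = ω ^ 2 := inv_eq_of_mul_eq_one_right (by linear_combination hω3)
  rw [hw₁, hw₂, hw₃, hωinv]
  have ha3 : (η z ^ ((1 : ℂ) / 3)) ^ 3 = η z := by
    rw [← Complex.cpow_nat_mul]
    norm_num
  have hab : η z ^ ((1 : ℂ) / 3) * η z ^ (-(1 : ℂ) / 3) = 1 := by
    rw [← Complex.cpow_add _ _ hη0]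
    norm_num
  generalize η z ^ ((1 : ℂ) / 3) = a at *
  generalize η z ^ (-(1 : ℂ) / 3) = b at *
  have hab3 : η z * b ^ 3 = 1 := by
    rw [← ha3]
    linear_combination (a ^ 2 * b ^ 2 + a * b + 1) * hab
  have hsum : a ^ 3 + b ^ 3 = 2 - 4 * z := by
    apply mul_left_cancel₀ hη0
    linear_combination hquad + hab3 + η z * ha3
  have hne : a ^ 3 ≠ b ^ 3 := fun h => by
    have hsq : (η z - 1) * (η z + 1) = 0 := by
      linear_combination hab3 + η z * h - η z * ha3
    rcases mul_eq_zero.mp hsq with h1 | h1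
    · simp [sub_eq_zero.mp h1] at him
    · simp [eq_neg_of_add_eq_zero_left h1] at him
  refine ⟨cubic_eq_zero_of_mul_eq_one hab hsum,
    cubic_eq_zero_of_mul_eq_one ?_ ?_, cubic_eq_zero_of_mul_eq_one ?_ ?_, ?_, ?_, ?_⟩
  · linear_combination a * b * hω3 + hab
  · linear_combination hsum + (a ^ 3 * (ω ^ 3 + 1) + b ^ 3) * hω3
  · linear_combination a * b * hω3 + hab
  · linear_combination hsum + (b ^ 3 * (ω ^ 3 + 1) + a ^ 3) * hω3
  · intro h
    have hb : b = ω ^ 2 * a := by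
      apply mul_left_cancel₀ hω1
      linear_combination -2 * h - a * hω3
    apply hne
    rw [hb]
    linear_combination -(a ^ 3 * (ω ^ 3 + 1)) * hω3
  · intro h
    have ha : a = ω ^ 2 * b := by
      apply mul_left_cancel₀ hω1
      linear_combination -2 * h - b * hω3
    apply hne
    rw [ha]
    linear_combination (b ^ 3 * (ω ^ 3 + 1)) * hω3
  · intro h
    have hE : a = b := by
      apply mul_left_cancel₀ (mul_ne_zero hω0 hω1)
      linear_combination 2 * h
    exact hne (by rw [hE])
end

section
/- For every real x < 0 there exist complex numbers L₊ and L₋ such that: w₂(z) → L₊ as z → x within the open upper half-plane intersected with Ω, and w₃(z) → L₊ as z → x within the open lower half-plane intersected with Ω; moreover w₂(z) → L₋ as z → x within the open lower half-plane intersected with Ω, and w₃(z) → L₋ as z → x within the open upper half-plane intersected with Ω. In particular the boundary values satisfy w₂,±(x) = w₃,∓(x) on (−∞,0). -/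
open Complex Filter Asymptotics Set

/-- Taking imaginary parts in `ζ + ζ⁻¹ = 2 - 4z`, with denominators cleared. -/
lemma im_mul_normSq_sub_one {z ζ : ℂ} (h : ζ ^ 2 + 4 * z * ζ - 2 * ζ + 1 = 0) :
    ζ.im * (normSq ζ - 1) = -4 * z.im * normSq ζ := by
  have h1 := congrArg Complex.re h
  have h2 := congrArg Complex.im h
  simp [pow_two] at h1 h2
  simp only [normSq_apply]
  linear_combination ζ.re * h2 - ζ.im * h1

lemma norm_lt_one_of_im_pos {z ζ : ℂ} (h : ζ ^ 2 + 4 * z * ζ - 2 * ζ + 1 = 0)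
    (hζ : 0 < ζ.im) (hz : 0 < z.im) : ‖ζ‖ < 1 := by
  have h1 := im_mul_normSq_sub_one h
  have hN : 0 < normSq ζ := normSq_pos.2 (by rintro rfl; simp at hζ)
  have h2 : normSq ζ < 1 := by
    by_contra! hc
    nlinarith [mul_nonneg hζ.le (sub_nonneg.2 hc), mul_pos hz hN]
  rw [normSq_eq_norm_sq] at h2
  nlinarith [norm_nonneg ζ]

lemma norm_inv_lt_one_of_im_neg {z ζ : ℂ} (h : ζ ^ 2 + 4 * z * ζ - 2 * ζ + 1 = 0)
    (hζ : 0 < ζ.im) (hz : z.im < 0) : ‖ζ⁻¹‖ < 1 := by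
  have h1 := im_mul_normSq_sub_one h
  have hN : 0 < normSq ζ := normSq_pos.2 (by rintro rfl; simp at hζ)
  have h2 : 1 < normSq ζ := by
    by_contra! hc
    nlinarith [mul_nonneg hζ.le (sub_nonneg.2 hc), mul_pos (neg_pos.2 hz) hN]
  rw [normSq_eq_norm_sq] at h2
  rw [norm_inv]
  exact inv_lt_one_of_one_lt₀ (by nlinarith [norm_nonneg ζ])

/-- For `x < 0` the quadratic has a root in `(0, 1)`. -/
lemma exists_small_root {x : ℝ} (hx : x < 0) :
    ∃ r : ℝ, 0 < r ∧ r < 1 ∧ r ^ 2 + 4 * x * r - 2 * r + 1 = 0 := by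
  have hs := Real.sq_sqrt (show (0 : ℝ) ≤ (1 - 2 * x) ^ 2 - 1 by nlinarith)
  have h0 := Real.sqrt_nonneg ((1 - 2 * x) ^ 2 - 1)
  set s := Real.sqrt ((1 - 2 * x) ^ 2 - 1)
  exact ⟨1 - 2 * x - s, by nlinarith, by nlinarith, by linear_combination hs⟩

/-- Roots inside the unit disc converge to the small root as `z → x`. -/
lemma tendsto_small_root {x r : ℝ} (hr0 : 0 < r) (hr1 : r < 1)
    (hr : r ^ 2 + 4 * x * r - 2 * r + 1 = 0) {s : Set ℂ} {ζ : ℂ → ℂ}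
    (h : ∀ z ∈ s, ζ z ^ 2 + 4 * z * ζ z - 2 * ζ z + 1 = 0) (h1 : ∀ z ∈ s, ‖ζ z‖ < 1) :
    Tendsto ζ (nhdsWithin (x : ℂ) s) (nhds (r : ℂ)) := by
  rw [tendsto_iff_norm_sub_tendsto_zero]
  have hlim : Tendsto (fun z : ℂ => 4 / (1 - r) * ‖z - x‖) (nhdsWithin (x : ℂ) s) (nhds 0) := by
    have : Continuous fun z : ℂ => 4 / (1 - r) * ‖z - x‖ := by fun_prop
    simpa using (this.tendsto (x : ℂ)).mono_left nhdsWithin_le_nhds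
  refine squeeze_zero' (Eventually.of_forall fun _ => norm_nonneg _) ?_ hlim
  filter_upwards [self_mem_nhdsWithin] with z hz
  have hrC : (r : ℂ) ^ 2 + 4 * x * r - 2 * r + 1 = 0 := by exact_mod_cast hr
  have hfac : (ζ z - r) * (r * ζ z - 1) = -(4 * r * ((z - x) * ζ z)) := by
    linear_combination r * h z hz - ζ z * hrC
  have hnorm := congrArg norm hfac
  simp only [norm_mul, norm_neg, norm_real, Real.norm_of_nonneg hr0.le, Complex.norm_ofNat] at hnorm
  have hlow : 1 - r ≤ ‖r * ζ z - 1‖ := by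
    have h2 := norm_sub_norm_le (1 : ℂ) (r * ζ z)
    rw [norm_sub_rev, norm_one, norm_mul, norm_real, Real.norm_of_nonneg hr0.le] at h2
    nlinarith [h1 z hz]
  have hup : r * (‖z - x‖ * ‖ζ z‖) ≤ 1 * (‖z - x‖ * 1) := by
    gcongr
    exact (h1 z hz).le
  rw [div_mul_eq_mul_div, le_div_iff₀ (by linarith)]
  nlinarith [mul_le_mul_of_nonneg_left hlow (norm_nonneg (ζ z - r))]

/-- Continuity of `a η^{1/3} + b η^{-1/3}` at a positive real limit. -/
lemma tendsto_cube_root_combination {l : Filter ℂ} {η w : ℂ → ℂ} {r : ℝ} (hr : 0 < r)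
    (hη : Tendsto η l (nhds (r : ℂ))) (a b : ℂ)
    (hw : ∀ z, w z = (1 / 2) * (a * η z ^ ((1 : ℂ) / 3) + b * η z ^ (-(1 : ℂ) / 3) + 1)) :
    Tendsto w l
      (nhds ((1 / 2) * (a * (r : ℂ) ^ ((1 : ℂ) / 3) + b * (r : ℂ) ^ (-(1 : ℂ) / 3) + 1))) := by
  rw [funext hw]
  have hs : (r : ℂ) ∈ slitPlane := ofReal_mem_slitPlane.2 hr
  have hc (c : ℂ) := hη.cpow (tendsto_const_nhds (x := c)) hs
  exact ((((hc _).const_mul a).add ((hc _).const_mul b)).add_const 1).const_mul _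

/-- Boundary values on `(-∞,0)`: `w₂,±(x) = w₃,∓(x)`. -/
theorem w2_w3_boundary_values_neg_axis
    (η : ℂ → ℂ)
    (hη : ∀ z ∈ Ω, 0 < (η z).im ∧ (η z) ^ 2 + 4 * z * (η z) - 2 * (η z) + 1 = 0)
    (w₁ w₂ w₃ : ℂ → ℂ)
    (hw₁ : ∀ z, w₁ z = (1 / 2) * ((η z) ^ ((1 : ℂ) / 3) + (η z) ^ (-(1 : ℂ) / 3) + 1))
    (hw₂ : ∀ z, w₂ z = (1 / 2) * (ω⁻¹ * (η z) ^ ((1 : ℂ) / 3) + ω * (η z) ^ (-(1 : ℂ) / 3) + 1))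
    (hw₃ : ∀ z, w₃ z = (1 / 2) * (ω * (η z) ^ ((1 : ℂ) / 3) + ω⁻¹ * (η z) ^ (-(1 : ℂ) / 3) + 1))
    (x : ℝ) (hx : x < 0) :
    ∃ Lp Lm : ℂ,
      Filter.Tendsto w₂ (nhdsWithin (x : ℂ) ({z : ℂ | 0 < z.im} ∩ Ω)) (nhds Lp) ∧
      Filter.Tendsto w₃ (nhdsWithin (x : ℂ) ({z : ℂ | z.im < 0} ∩ Ω)) (nhds Lp) ∧
      Filter.Tendsto w₂ (nhdsWithin (x : ℂ) ({z : ℂ | z.im < 0} ∩ Ω)) (nhds Lm) ∧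
      Filter.Tendsto w₃ (nhdsWithin (x : ℂ) ({z : ℂ | 0 < z.im} ∩ Ω)) (nhds Lm) := by
  obtain ⟨r, hr0, hr1, hr⟩ := exists_small_root hx
  have hup : Tendsto η (nhdsWithin (x : ℂ) ({z : ℂ | 0 < z.im} ∩ Ω)) (nhds (r : ℂ)) :=
    tendsto_small_root hr0 hr1 hr (fun z hz => (hη z hz.2).2)
      fun z hz => norm_lt_one_of_im_pos (hη z hz.2).2 (hη z hz.2).1 hz.1
  have hdown : Tendsto η (nhdsWithin (x : ℂ) ({z : ℂ | z.im < 0} ∩ Ω)) (nhds ((r⁻¹ : ℝ) : ℂ)) := by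
    have hinv : Tendsto (fun z => (η z)⁻¹) (nhdsWithin (x : ℂ) ({z : ℂ | z.im < 0} ∩ Ω))
        (nhds (r : ℂ)) := by
      refine tendsto_small_root hr0 hr1 hr (fun z hz => ?_)
        fun z hz => norm_inv_lt_one_of_im_neg (hη z hz.2).2 (hη z hz.2).1 hz.1
      obtain ⟨him, heq⟩ := hη z hz.2
      have hne : η z ≠ 0 := fun h0 => by simp [h0] at him
      field_simp
      linear_combination heq
    simpa using hinv.inv₀ (by exact_mod_cast hr0.ne')
  have hneg : -(1 : ℂ) / 3 = -(1 / 3) := by ring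
  have harg : (r : ℂ).arg ≠ Real.pi := by
    rw [arg_ofReal_of_nonneg hr0.le]
    exact Real.pi_pos.ne
  have hpos : ((r⁻¹ : ℝ) : ℂ) ^ ((1 : ℂ) / 3) = (r : ℂ) ^ (-(1 : ℂ) / 3) := by
    rw [ofReal_inv, inv_cpow _ _ harg, hneg, cpow_neg]
  have hnegpow : ((r⁻¹ : ℝ) : ℂ) ^ (-(1 : ℂ) / 3) = (r : ℂ) ^ ((1 : ℂ) / 3) := by
    rw [ofReal_inv, inv_cpow _ _ harg, hneg, cpow_neg, inv_inv]
  refine ⟨_, _, tendsto_cube_root_combination hr0 hup _ _ hw₂, ?_, ?_,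
    tendsto_cube_root_combination hr0 hup _ _ hw₃⟩
  · have h := tendsto_cube_root_combination (inv_pos.2 hr0) hdown _ _ hw₃
    rwa [hpos, hnegpow, add_comm (ω * _)] at h
  · have h := tendsto_cube_root_combination (inv_pos.2 hr0) hdown _ _ hw₂
    rwa [hpos, hnegpow, add_comm (ω⁻¹ * _)] at h
end

section
/- Let z ∈ Ω and write η(z) = r·e^{iθ} in polar form with r > 0 and θ ∈ (0,π). Then Re(λ*₂(z) − λ*₁(z)) = −(3/2^{4/3})·(r^{2/3} + r^{−2/3})·sin((π + 2θ)/3)·sin(π/3); in particular Re(λ*₂(z) − λ*₁(z)) < 0 for all z ∈ Ω. -/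
open Complex Filter Asymptotics Set

/-- Principal complex powers in polar form. -/
lemma cpow_polar {r θ : ℝ} (hr : 0 < r) (hθ : θ ∈ Set.Ioo 0 Real.pi) (c : ℂ) :
    ((r : ℂ) * exp (θ * I)) ^ c = exp ((Real.log r + θ * I) * c) := by
  have hlog : log ((r : ℂ) * exp (θ * I)) = Real.log r + θ * I := by
    rw [log_ofReal_mul hr (exp_ne_zero _), log_exp] <;> simp
    · linarith [hθ.1, Real.pi_pos]
    · exact hθ.2.le
  rw [cpow_def_of_ne_zero (mul_ne_zero (ofReal_ne_zero.2 hr.ne') (exp_ne_zero _)), hlog]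

/-- The symmetric combination of squared inverse pairs of exponentials. -/
lemma exp_add_exp_neg_sq (u : ℂ) : (exp u + exp (-u)) ^ 2 = exp (2 * u) + exp (-(2 * u)) + 2 := by
  have h : exp u * exp (-u) = 1 := by rw [← exp_add]; simp
  have h₁ : exp (2 * u) = exp u ^ 2 := by rw [← exp_nat_mul]; simp
  have h₂ : exp (-(2 * u)) = exp (-u) ^ 2 := by rw [← exp_nat_mul]; congr 1; push_cast; ring
  rw [h₁, h₂]
  linear_combination 2 * h

lemma exp_add_exp_neg_re (x y : ℝ) :
    (exp (x + y * I) + exp (-(x + y * I))).re = (Real.exp x + Real.exp (-x)) * Real.cos y := by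
  simp [exp_re]
  ring

lemma cos_sub_cos_four_pi_div_three (y : ℝ) :
    Real.cos (y - 4 * Real.pi / 3) - Real.cos y =
      -2 * Real.sin (y + Real.pi / 3) * Real.sin (Real.pi / 3) := by
  rw [← Real.cos_add_two_pi, Real.cos_sub_cos, show
    (y - 4 * Real.pi / 3 + 2 * Real.pi + y) / 2 = y + Real.pi / 3 by ring, show
    (y - 4 * Real.pi / 3 + 2 * Real.pi - y) / 2 = Real.pi / 3 by ring]

/-- In terms of the polar form `η(z) = r·e^{iθ}` with `r > 0`, `θ ∈ (0,π)`, one has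
`Re(λ*₂ − λ*₁) = −(3/2^{4/3})(r^{2/3}+r^{−2/3}) sin((π+2θ)/3) sin(π/3)`; in particular
`Re(λ*₂ − λ*₁) < 0` on `Ω`. -/
theorem re_lambdaStar_difference_polar
    (η : ℂ → ℂ)
    (hη : ∀ z ∈ Ω, 0 < (η z).im ∧ (η z) ^ 2 + 4 * z * (η z) - 2 * (η z) + 1 = 0)
    (w₁ w₂ w₃ : ℂ → ℂ)
    (hw₁ : ∀ z, w₁ z = (1 / 2) * ((η z) ^ ((1 : ℂ) / 3) + (η z) ^ (-(1 : ℂ) / 3) + 1))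
    (hw₂ : ∀ z, w₂ z = (1 / 2) * (ω⁻¹ * (η z) ^ ((1 : ℂ) / 3) + ω * (η z) ^ (-(1 : ℂ) / 3) + 1))
    (hw₃ : ∀ z, w₃ z = (1 / 2) * (ω * (η z) ^ ((1 : ℂ) / 3) + ω⁻¹ * (η z) ^ (-(1 : ℂ) / 3) + 1))
    (lamStar₁ lamStar₂ lamStar₃ : ℂ → ℂ)
    (hls₁ : ∀ z, lamStar₁ z =
      ((3 / (2 : ℝ) ^ ((1 : ℝ) / 3) : ℝ) : ℂ) * (w₁ z) ^ 2
        - ((3 / (2 : ℝ) ^ ((1 : ℝ) / 3) : ℝ) : ℂ) * w₁ z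
        - ((3 / (2 : ℝ) ^ ((7 : ℝ) / 3) : ℝ) : ℂ))
    (hls₂ : ∀ z, lamStar₂ z =
      ((3 / (2 : ℝ) ^ ((1 : ℝ) / 3) : ℝ) : ℂ) * (w₂ z) ^ 2
        - ((3 / (2 : ℝ) ^ ((1 : ℝ) / 3) : ℝ) : ℂ) * w₂ z
        - ((3 / (2 : ℝ) ^ ((7 : ℝ) / 3) : ℝ) : ℂ))
    (hls₃ : ∀ z, lamStar₃ z =
      ((3 / (2 : ℝ) ^ ((1 : ℝ) / 3) : ℝ) : ℂ) * (w₃ z) ^ 2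
        - ((3 / (2 : ℝ) ^ ((1 : ℝ) / 3) : ℝ) : ℂ) * w₃ z
        - ((3 / (2 : ℝ) ^ ((7 : ℝ) / 3) : ℝ) : ℂ))
    (z : ℂ) (hz : z ∈ Ω) (r θ : ℝ) (hr : 0 < r) (hθ : θ ∈ Set.Ioo 0 Real.pi)
    (hpolar : η z = (r : ℂ) * Complex.exp (θ * Complex.I)) :
    (lamStar₂ z - lamStar₁ z).re =
      -(3 / (2 : ℝ) ^ ((4 : ℝ) / 3)) * (r ^ ((2 : ℝ) / 3) + r ^ (-(2 : ℝ) / 3))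
        * Real.sin ((Real.pi + 2 * θ) / 3) * Real.sin (Real.pi / 3) ∧
    (lamStar₂ z - lamStar₁ z).re < 0 := by
  have hformula : (lamStar₂ z - lamStar₁ z).re =
      -(3 / (2 : ℝ) ^ ((4 : ℝ) / 3)) * (r ^ ((2 : ℝ) / 3) + r ^ (-(2 : ℝ) / 3))
        * Real.sin ((Real.pi + 2 * θ) / 3) * Real.sin (Real.pi / 3) := by
    set u : ℂ := (Real.log r + θ * I) / 3 with hu
    set v : ℂ := 2 * Real.pi * I / 3 with hv
    have hω : ω = exp v := rfl
    have ha : η z ^ ((1 : ℂ) / 3) = exp u := by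
      rw [hpolar, cpow_polar hr hθ, hu]; congr 1; ring
    have hb : η z ^ (-(1 : ℂ) / 3) = exp (-u) := by
      rw [hpolar, cpow_polar hr hθ, hu]; congr 1; ring
    have h₂ : ω⁻¹ * exp u + ω * exp (-u) = exp (u - v) + exp (-(u - v)) := by
      rw [hω, ← exp_neg, ← exp_add, ← exp_add]; congr 2 <;> ring
    have hdiff : lamStar₂ z - lamStar₁ z = ((3 / (2 : ℝ) ^ ((1 : ℝ) / 3) / 4 : ℝ) : ℂ) *
        ((exp (2 * (u - v)) + exp (-(2 * (u - v)))) - (exp (2 * u) + exp (-(2 * u)))) := by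
      have e₁ := exp_add_exp_neg_sq u
      have e₂ := exp_add_exp_neg_sq (u - v)
      rw [hls₂, hls₁, hw₁, hw₂, ha, hb, h₂, ofReal_div _ 4, ofReal_ofNat]
      linear_combination ((3 / (2 : ℝ) ^ ((1 : ℝ) / 3) : ℝ) : ℂ) / 4 * (e₂ - e₁)
    have hu' : 2 * u = ((2 / 3 * Real.log r : ℝ) : ℂ) + ((2 * θ / 3 : ℝ) : ℂ) * I := by
      rw [hu]; push_cast; ring
    have huv : 2 * (u - v) = ((2 / 3 * Real.log r : ℝ) : ℂ) +
        ((2 * θ / 3 - 4 * Real.pi / 3 : ℝ) : ℂ) * I := by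
      rw [hu, hv]; push_cast; ring
    have hpow : (2 : ℝ) ^ ((4 : ℝ) / 3) = 2 * (2 : ℝ) ^ ((1 : ℝ) / 3) := by
      rw [show (4 : ℝ) / 3 = 1 + 1 / 3 by norm_num, Real.rpow_add two_pos, Real.rpow_one]
    have hs : r ^ ((2 : ℝ) / 3) = Real.exp (2 / 3 * Real.log r) := by
      rw [Real.rpow_def_of_pos hr, mul_comm]
    have hs' : r ^ (-(2 : ℝ) / 3) = Real.exp (-(2 / 3 * Real.log r)) := by
      rw [Real.rpow_def_of_pos hr]; congr 1; ring
    have hcos := cos_sub_cos_four_pi_div_three (2 * θ / 3)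
    rw [hdiff, re_ofReal_mul, sub_re, huv, hu', exp_add_exp_neg_re, exp_add_exp_neg_re,
      ← mul_sub, hcos, hs, hs', hpow,
      show (Real.pi + 2 * θ) / 3 = 2 * θ / 3 + Real.pi / 3 by ring]
    field_simp
    ring
  refine ⟨hformula, ?_⟩
  have hsin : 0 < Real.sin ((Real.pi + 2 * θ) / 3) :=
    Real.sin_pos_of_pos_of_lt_pi (by linarith [hθ.1, Real.pi_pos]) (by linarith [hθ.2])
  have hsin' : 0 < Real.sin (Real.pi / 3) :=
    Real.sin_pos_of_pos_of_lt_pi (by positivity) (by linarith [Real.pi_pos])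
  rw [hformula, neg_mul, neg_mul, neg_mul, neg_lt_zero]
  positivity
end

section
/- For every real x < 0: η(z) → 1 − 2x − 2√(x(x−1)) as z → x within the open upper half-plane intersected with Ω, and η(z) → 1 − 2x + 2√(x(x−1)) as z → x within the open lower half-plane intersected with Ω, where √(x(x−1)) is the positive real square root (note x(x−1) > 0 for x < 0). In particular the two boundary values η₊(x), η₋(x) are real and satisfy η₊(x)·η₋(x) = 1. -/
open Complex Filter Asymptotics Set

/-- The imaginary part of `η + 1/η = 2 - 4z`, cleared of denominators. -/
lemma im_mul_one_sub_normSq {z w : ℂ} (h : w ^ 2 + 4 * z * w - 2 * w + 1 = 0) :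
    w.im * (1 - normSq w) = 4 * z.im * normSq w := by
  have hre := congrArg Complex.re h
  have him := congrArg Complex.im h
  simp only [pow_two, add_re, sub_re, mul_re, add_im, sub_im, mul_im, one_re, one_im, zero_re,
    zero_im, re_ofNat, im_ofNat] at hre him
  rw [normSq_apply]
  linear_combination w.im * hre - w.re * him

lemma norm_lt_one_of_im_pos_s19 {z w : ℂ} (h : w ^ 2 + 4 * z * w - 2 * w + 1 = 0)
    (hw : 0 < w.im) (hz : 0 < z.im) : ‖w‖ < 1 := by
  have hN : 0 < normSq w := normSq_pos.2 (by rintro rfl; simp at hw)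
  have h1 : 0 < w.im * (1 - normSq w) := by rw [im_mul_one_sub_normSq h]; positivity
  have h2 := (mul_pos_iff_of_pos_left hw).1 h1
  rw [normSq_eq_norm_sq] at h2
  nlinarith [norm_nonneg w]

lemma one_lt_norm_of_im_neg {z w : ℂ} (h : w ^ 2 + 4 * z * w - 2 * w + 1 = 0)
    (hw : 0 < w.im) (hz : z.im < 0) : 1 < ‖w‖ := by
  have hN : 0 < normSq w := normSq_pos.2 (by rintro rfl; simp at hw)
  have h1 : 0 < w.im * (normSq w - 1) := by
    nlinarith [im_mul_one_sub_normSq h, mul_pos (neg_pos.2 hz) hN]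
  have h2 := (mul_pos_iff_of_pos_left hw).1 h1
  rw [normSq_eq_norm_sq] at h2
  nlinarith [norm_nonneg w]

/-- If `a`, `b` are the roots of the equation at the real point `x`, then the distances of a root
at `z` to `a` and `b` are controlled by `z - x`. -/
lemma norm_sub_mul_norm_sub {z w : ℂ} {x a b : ℝ} (h : w ^ 2 + 4 * z * w - 2 * w + 1 = 0)
    (hadd : a + b = 2 - 4 * x) (hmul : a * b = 1) :
    ‖w - a‖ * ‖w - b‖ = 4 * ‖z - x‖ * ‖w‖ := by
  have hadd' : (a : ℂ) + b = 2 - 4 * x := mod_cast hadd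
  have hmul' : (a : ℂ) * b = 1 := mod_cast hmul
  have key : (w - a) * (w - b) = -(4 * (z - x) * w) := by
    linear_combination h - w * hadd' + hmul'
  rw [← norm_mul, key]
  simp

lemma norm_sub_le_of_im_pos {z w : ℂ} {x a b : ℝ} (h : w ^ 2 + 4 * z * w - 2 * w + 1 = 0)
    (hw : 0 < w.im) (hz : 0 < z.im) (hadd : a + b = 2 - 4 * x) (hmul : a * b = 1) (hb : 1 < b) :
    ‖w - a‖ ≤ 4 / (b - 1) * ‖z - x‖ := by
  have hw1 := norm_lt_one_of_im_pos_s19 h hw hz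
  have hp := norm_sub_mul_norm_sub h hadd hmul
  have hd : b - 1 ≤ ‖w - b‖ := by
    have := norm_sub_norm_le (b : ℂ) w
    rw [norm_sub_rev, Complex.norm_of_nonneg (by linarith)] at this
    linarith
  rw [div_mul_eq_mul_div, le_div_iff₀ (by linarith)]
  nlinarith [mul_le_mul_of_nonneg_left hd (norm_nonneg (w - a)),
    mul_le_mul_of_nonneg_left hw1.le (norm_nonneg (z - x))]

lemma norm_sub_le_of_im_neg {z w : ℂ} {x a b : ℝ} (h : w ^ 2 + 4 * z * w - 2 * w + 1 = 0)
    (hw : 0 < w.im) (hz : z.im < 0) (hadd : a + b = 2 - 4 * x) (hmul : a * b = 1)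
    (ha0 : 0 < a) (ha : a < 1) :
    ‖w - b‖ ≤ 4 / (1 - a) * ‖z - x‖ := by
  have hw1 := one_lt_norm_of_im_neg h hw hz
  have hp := norm_sub_mul_norm_sub h hadd hmul
  have hd : (1 - a) * ‖w‖ ≤ ‖w - a‖ := by
    have := norm_sub_norm_le w (a : ℂ)
    rw [Complex.norm_of_nonneg ha0.le] at this
    nlinarith
  rw [div_mul_eq_mul_div, le_div_iff₀ (by linarith)]
  refine le_of_mul_le_mul_right ?_ (zero_lt_one.trans hw1)
  nlinarith [mul_le_mul_of_nonneg_left hd (norm_nonneg (w - b))]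

lemma tendsto_nhdsWithin_of_norm_sub_le {f : ℂ → ℂ} {S : Set ℂ} {p c : ℂ} {C : ℝ}
    (h : ∀ z ∈ S, ‖f z - c‖ ≤ C * ‖z - p‖) : Tendsto f (nhdsWithin p S) (nhds c) := by
  rw [tendsto_iff_norm_sub_tendsto_zero]
  refine squeeze_zero' (Eventually.of_forall fun _ => norm_nonneg _)
    (eventually_nhdsWithin_of_forall h) (tendsto_nhdsWithin_of_tendsto_nhds ?_)
  have : Continuous fun z : ℂ => C * ‖z - p‖ := by fun_prop
  simpa using this.tendsto p

/-- Boundary values of `η` on `(-∞,0)`: `η±(x) = 1 − 2x ∓ 2√(x(x−1))`, and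
`η₊(x)·η₋(x) = 1`. -/
theorem eta_boundary_values_neg_axis
    (η : ℂ → ℂ)
    (hη : ∀ z ∈ Ω, 0 < (η z).im ∧ (η z) ^ 2 + 4 * z * (η z) - 2 * (η z) + 1 = 0)
    (x : ℝ) (hx : x < 0) :
    Filter.Tendsto η (nhdsWithin (x : ℂ) ({z : ℂ | 0 < z.im} ∩ Ω))
      (nhds ((1 - 2 * x - 2 * Real.sqrt (x * (x - 1)) : ℝ) : ℂ)) ∧
    Filter.Tendsto η (nhdsWithin (x : ℂ) ({z : ℂ | z.im < 0} ∩ Ω))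
      (nhds ((1 - 2 * x + 2 * Real.sqrt (x * (x - 1)) : ℝ) : ℂ)) ∧
    (1 - 2 * x - 2 * Real.sqrt (x * (x - 1))) *
      (1 - 2 * x + 2 * Real.sqrt (x * (x - 1))) = 1 := by
  have hs : Real.sqrt (x * (x - 1)) ^ 2 = x * (x - 1) := Real.sq_sqrt (by nlinarith)
  have hs0 : 0 ≤ Real.sqrt (x * (x - 1)) := Real.sqrt_nonneg _
  set s := Real.sqrt (x * (x - 1))
  have hmul : (1 - 2 * x - 2 * s) * (1 - 2 * x + 2 * s) = 1 := by linear_combination -4 * hs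
  have hadd : (1 - 2 * x - 2 * s) + (1 - 2 * x + 2 * s) = 2 - 4 * x := by ring
  have hb : 1 < 1 - 2 * x + 2 * s := by linarith
  have ha0 : 0 < 1 - 2 * x - 2 * s := by
    refine pos_of_mul_pos_left (b := 1 - 2 * x + 2 * s) ?_ (by linarith)
    rw [hmul]
    exact one_pos
  have ha : 1 - 2 * x - 2 * s < 1 := by nlinarith
  exact ⟨tendsto_nhdsWithin_of_norm_sub_le fun z hz =>
      norm_sub_le_of_im_pos (hη z hz.2).2 (hη z hz.2).1 hz.1 hadd hmul hb,
    tendsto_nhdsWithin_of_norm_sub_le fun z hz =>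
      norm_sub_le_of_im_neg (hη z hz.2).2 (hη z hz.2).1 hz.1 hadd hmul ha0 ha, hmul⟩
end
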